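/- arXiv:1909.03494 — 8 statements merged into one kernel-verified Lean document; each statement's English description precedes it below -/
import Mathlib

section
/- Let (X, ‖·‖) be a Banach space and let T : X → X be a (k,b)-enriched Chatterjea mapping with k ∈ [0,∞) and b ∈ [0,1/2). Then T has a unique fixed point p ∈ X, and setting λ = 1/(k+1) ∈ (0,1], for every x₀ ∈ X the Krasnoselskij iteration defined by x_{n+1} = (1−λ)x_n + λ T x_n converges to p. -/
open Filter Topology

/-- A Chatterjea mapping with constant `b`. -/
def IsChatterjea {X : Type*} [PseudoMetricSpace X] (b : ℝ) (S : X → X) : Prop :=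
  ∀ x y, dist (S x) (S y) ≤ b * (dist x (S y) + dist y (S x))

namespace IsChatterjea

section PseudoMetricSpace

variable {X : Type*} [PseudoMetricSpace X] {b : ℝ} {S : X → X}

theorem dist_map_map_le (h : IsChatterjea b S) (hb0 : 0 ≤ b) (hb : b < 1) (x : X) :
    dist (S x) (S (S x)) ≤ b / (1 - b) * dist x (S x) := by
  have h₁ := h x (S x)
  rw [dist_self, add_zero] at h₁
  have h₂ := mul_le_mul_of_nonneg_left (dist_triangle x (S x) (S (S x))) hb0
  rw [div_mul_eq_mul_div, le_div_iff₀ (by linarith)]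
  linarith

theorem dist_iterate_le (h : IsChatterjea b S) (hb0 : 0 ≤ b) (hb : b < 1) {u : ℕ → X}
    (hu : ∀ n, u (n + 1) = S (u n)) (n : ℕ) :
    dist (u n) (u (n + 1)) ≤ dist (u 0) (u 1) * (b / (1 - b)) ^ n := by
  induction n with
  | zero => simp
  | succ n ih =>
    have hr : 0 ≤ b / (1 - b) := div_nonneg hb0 (by linarith)
    calc dist (u (n + 1)) (u (n + 1 + 1))
        ≤ b / (1 - b) * dist (u n) (u (n + 1)) := by
          rw [hu (n + 1), hu n]
          exact h.dist_map_map_le hb0 hb _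
      _ ≤ b / (1 - b) * (dist (u 0) (u 1) * (b / (1 - b)) ^ n) := by gcongr
      _ = dist (u 0) (u 1) * (b / (1 - b)) ^ (n + 1) := by ring

theorem cauchySeq_iterate (h : IsChatterjea b S) (hb0 : 0 ≤ b) (hb : b < 1 / 2) {u : ℕ → X}
    (hu : ∀ n, u (n + 1) = S (u n)) : CauchySeq u :=
  cauchySeq_of_le_geometric _ _ ((div_lt_one (by linarith)).2 (by linarith))
    (h.dist_iterate_le hb0 (by linarith) hu)

end PseudoMetricSpace

variable {X : Type*} [MetricSpace X] {b : ℝ} {S : X → X}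

theorem map_eq_of_tendsto (h : IsChatterjea b S) (hb : b < 1) {u : ℕ → X}
    (hu : ∀ n, u (n + 1) = S (u n)) {p : X} (hp : Tendsto u atTop (𝓝 p)) : S p = p := by
  have hp' := (tendsto_add_atTop_iff_nat 1).2 hp
  have hle : dist p (S p) ≤ b * (dist p (S p) + dist p p) :=
    le_of_tendsto_of_tendsto' (hp'.dist tendsto_const_nhds)
      (((hp.dist tendsto_const_nhds).add (tendsto_const_nhds.dist hp')).const_mul b)
      fun n => by rw [hu]; exact h _ _
  rw [dist_self, add_zero] at hle
  refine (dist_le_zero.1 ?_).symm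
  nlinarith [dist_nonneg (x := p) (y := S p)]

theorem fixedPoint_unique (h : IsChatterjea b S) (hb : b < 1 / 2) {p q : X}
    (hp : S p = p) (hq : S q = q) : p = q := by
  have hpq := h p q
  rw [hp, hq, dist_comm q p] at hpq
  refine dist_le_zero.1 ?_
  nlinarith [dist_nonneg (x := p) (y := q)]

/-- **Chatterjea's fixed point theorem**. -/
theorem exists_fixedPoint [CompleteSpace X] [Nonempty X] (h : IsChatterjea b S) (hb0 : 0 ≤ b)
    (hb : b < 1 / 2) :
    ∃ p, S p = p ∧ ∀ u : ℕ → X, (∀ n, u (n + 1) = S (u n)) → Tendsto u atTop (𝓝 p) := by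
  have key : ∀ u : ℕ → X, (∀ n, u (n + 1) = S (u n)) → ∃ p, S p = p ∧ Tendsto u atTop (𝓝 p) := by
    intro u hu
    obtain ⟨p, hp⟩ := cauchySeq_tendsto_of_complete (h.cauchySeq_iterate hb0 hb hu)
    exact ⟨p, h.map_eq_of_tendsto (by linarith) hu hp, hp⟩
  obtain ⟨x⟩ := ‹Nonempty X›
  obtain ⟨p, hp, -⟩ := key (fun n => S^[n] x) fun n => Function.iterate_succ_apply' S n x
  refine ⟨p, hp, fun u hu => ?_⟩
  obtain ⟨q, hq, hlim⟩ := key u hu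
  rwa [h.fixedPoint_unique hb hp hq]

end IsChatterjea

/-- The averaged operator of an enriched Chatterjea mapping is a Chatterjea mapping. -/
theorem isChatterjea_averaged {X : Type*} [NormedAddCommGroup X] [NormedSpace ℝ X]
    {T : X → X} {k b : ℝ} (hk : 0 ≤ k)
    (hT : ∀ x y : X, ‖k • (x - y) + (T x - T y)‖ ≤
      b * (‖(k + 1) • (x - y) + (y - T y)‖ + ‖(k + 1) • (y - x) + (x - T x)‖)) :
    IsChatterjea b fun x => (1 - 1 / (k + 1)) • x + (1 / (k + 1)) • T x := by
  have hk1 : 0 < k + 1 := by linarith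
  set S : X → X := fun x => (1 - 1 / (k + 1)) • x + (1 / (k + 1)) • T x with hS
  have hST (x : X) : T x = (k + 1) • S x - k • x := by
    simp only [hS]
    match_scalars <;> field_simp
    ring
  have hnorm (x : X) : ‖(k + 1) • x‖ = (k + 1) * ‖x‖ := by
    rw [norm_smul, Real.norm_of_nonneg hk1.le]
  intro x y
  have hxy := hT x y
  have hdiff : k • (x - y) + (T x - T y) = (k + 1) • (S x - S y) := by
    rw [hST, hST]; module
  have hcross (x y : X) : (k + 1) • (x - y) + (y - T y) = (k + 1) • (x - S y) := by
    rw [hST]; module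
  rw [hdiff, hcross, hcross, hnorm, hnorm, hnorm] at hxy
  simp only [dist_eq_norm]
  refine le_of_mul_le_mul_left ?_ hk1
  linarith

/-- **Theorem 2 (i)-(ii)**: a `(k,b)`-enriched Chatterjea mapping on a Banach space has a
unique fixed point `p`, and the Krasnoselskij iteration with `λ = 1/(k+1)` converges to `p`
from any starting point. -/
theorem enrichedChatterjea_fixedPoint_krasnoselskij
    {X : Type*} [NormedAddCommGroup X] [NormedSpace ℝ X] [CompleteSpace X]
    (T : X → X) (k b : ℝ) (hk : 0 ≤ k) (hb0 : 0 ≤ b) (hb : b < 1 / 2)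
    (hT : ∀ x y : X, ‖k • (x - y) + (T x - T y)‖ ≤
      b * (‖(k + 1) • (x - y) + (y - T y)‖ + ‖(k + 1) • (y - x) + (x - T x)‖)) :
    ∃ p : X, T p = p ∧ (∀ q : X, T q = q → q = p) ∧
      ∀ (x₀ : X) (u : ℕ → X), u 0 = x₀ →
        (∀ n, u (n + 1) = (1 - 1 / (k + 1)) • u n + (1 / (k + 1)) • T (u n)) →
        Filter.Tendsto u Filter.atTop (nhds p) := by
  have hk1 : k + 1 ≠ 0 := by positivity
  have hfix (x : X) : (1 - 1 / (k + 1)) • x + (1 / (k + 1)) • T x = x ↔ T x = x := by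
    have hsub : (1 - 1 / (k + 1)) • x + (1 / (k + 1)) • T x - x = (1 / (k + 1)) • (T x - x) := by
      module
    rw [← sub_eq_zero, hsub, smul_eq_zero_iff_right (one_div_ne_zero hk1), sub_eq_zero]
  have hS := isChatterjea_averaged hk hT
  obtain ⟨p, hp, hlim⟩ := hS.exists_fixedPoint hb0 hb
  exact ⟨p, (hfix p).1 hp, fun q hq => hS.fixedPoint_unique hb ((hfix q).2 hq) hp,
    fun _ u _ hu => hlim u hu⟩
end

section
/- Let (X, ‖·‖) be a Banach space, T : X → X a (k,b)-enriched Chatterjea mapping with k ∈ [0,∞) and b ∈ [0,1/2), p the unique fixed point of T, λ = 1/(k+1), and (x_n) the Krasnoselskij iteration x_{n+1} = (1−λ)x_n + λ T x_n starting from any x₀ ∈ X. Then with δ = b/(1−b) ∈ [0,1), the a priori error estimate ‖x_n − p‖ ≤ (δⁿ/(1−δ))·‖x₁ − x₀‖ holds for all n ≥ 1. -/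
/-- The Krasnoselskij averaged map of a `(k,b)`-enriched Chatterjea mapping contracts distances to
a fixed point by the factor `b / (1 - b)`. -/
theorem norm_averaged_sub_fixedPoint_le
    {X : Type*} [NormedAddCommGroup X] [NormedSpace ℝ X]
    {T : X → X} {k b : ℝ} (hk : 0 ≤ k) (hb : b < 1)
    (hT : ∀ x y : X, ‖k • (x - y) + (T x - T y)‖ ≤
      b * (‖(k + 1) • (x - y) + (y - T y)‖ + ‖(k + 1) • (y - x) + (x - T x)‖))
    {p : X} (hp : T p = p) (x : X) :
    ‖(1 - 1 / (k + 1)) • x + (1 / (k + 1)) • T x - p‖ ≤ b / (1 - b) * ‖x - p‖ := by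
  have hc : 0 < k + 1 := by linarith
  set s := (1 - 1 / (k + 1)) • x + (1 / (k + 1)) • T x with hs
  have hsmul : (k + 1) • s = k • x + T x := by
    rw [hs, smul_add, smul_smul, smul_smul, mul_one_div_cancel hc.ne', one_smul]
    congr 2
    field_simp
    ring
  have hleft : k • (x - p) + (T x - p) = (k + 1) • (s - p) := by
    rw [smul_sub (k + 1), hsmul]; module
  have hright : (k + 1) • (p - x) + (x - T x) = (k + 1) • (p - s) := by
    rw [smul_sub (k + 1) p s, hsmul]; module
  have h := hT x p
  rw [hp, hleft, hright, sub_self, add_zero, norm_smul, norm_smul, norm_smul, norm_sub_rev p s,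
    Real.norm_of_nonneg hc.le, ← mul_add, mul_left_comm] at h
  have h' := le_of_mul_le_mul_left h hc
  rw [div_mul_eq_mul_div, le_div_iff₀ (by linarith)]
  linarith

/-- **Theorem 2 (iii), a priori estimate**: for a `(k,b)`-enriched Chatterjea mapping `T` with
unique fixed point `p`, the Krasnoselskij iteration with `λ = 1/(k+1)` satisfies
`‖xₙ - p‖ ≤ δⁿ/(1-δ) · ‖x₁ - x₀‖` for all `n ≥ 1`, where `δ = b/(1-b)`. -/
theorem enrichedChatterjea_apriori_estimate
    {X : Type*} [NormedAddCommGroup X] [NormedSpace ℝ X] [CompleteSpace X]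
    (T : X → X) (k b : ℝ) (hk : 0 ≤ k) (hb0 : 0 ≤ b) (hb : b < 1 / 2)
    (hT : ∀ x y : X, ‖k • (x - y) + (T x - T y)‖ ≤
      b * (‖(k + 1) • (x - y) + (y - T y)‖ + ‖(k + 1) • (y - x) + (x - T x)‖))
    (p : X) (hp : T p = p) (hpu : ∀ q : X, T q = q → q = p)
    (x₀ : X) (u : ℕ → X) (hu0 : u 0 = x₀)
    (hu : ∀ n, u (n + 1) = (1 - 1 / (k + 1)) • u n + (1 / (k + 1)) • T (u n)) :
    ∀ n : ℕ, 1 ≤ n →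
      ‖u n - p‖ ≤ (b / (1 - b)) ^ n / (1 - b / (1 - b)) * ‖u 1 - u 0‖ := by
  have hδ : b / (1 - b) < 1 := by
    rw [div_lt_one (by linarith)]
    linarith
  have hδ0 : 0 ≤ b / (1 - b) := div_nonneg hb0 (by linarith)
  have hstep (n : ℕ) : ‖u (n + 1) - p‖ ≤ b / (1 - b) * ‖u n - p‖ := by
    rw [hu n]
    exact norm_averaged_sub_fixedPoint_le hk (by linarith) hT hp (u n)
  have hpow (n : ℕ) : ‖u n - p‖ ≤ (b / (1 - b)) ^ n * ‖u 0 - p‖ := by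
    induction n with
    | zero => simp
    | succ n ih =>
      rw [pow_succ', mul_assoc]
      exact (hstep n).trans (mul_le_mul_of_nonneg_left ih hδ0)
  have hzero : ‖u 0 - p‖ ≤ ‖u 1 - u 0‖ / (1 - b / (1 - b)) := by
    rw [le_div_iff₀ (by linarith)]
    have htri := norm_sub_le_norm_sub_add_norm_sub (u 0) (u 1) p
    rw [norm_sub_rev (u 0) (u 1)] at htri
    linarith [hstep 0]
  intro n _
  rw [div_mul_eq_mul_div, mul_div_assoc]
  exact (hpow n).trans (mul_le_mul_of_nonneg_left hzero (pow_nonneg hδ0 n))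
end

section
/- Let (X, ‖·‖) be a Banach space, T : X → X a (k,b)-enriched Chatterjea mapping with k ∈ [0,∞) and b ∈ [0,1/2), p the unique fixed point of T, λ = 1/(k+1), and (x_n) the Krasnoselskij iteration x_{n+1} = (1−λ)x_n + λ T x_n starting from any x₀ ∈ X. Then with δ = b/(1−b) ∈ [0,1), the a posteriori error estimate ‖x_n − p‖ ≤ (δ/(1−δ))·‖x_n − x_{n−1}‖ holds for all n ≥ 1. -/
/-- **Theorem 2 (iii), a posteriori estimate**: for a `(k,b)`-enriched Chatterjea mapping `T`
with unique fixed point `p`, the Krasnoselskij iteration with `λ = 1/(k+1)` satisfies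
`‖xₙ - p‖ ≤ δ/(1-δ) · ‖xₙ - xₙ₋₁‖` for all `n ≥ 1`, where `δ = b/(1-b)`. -/
theorem enrichedChatterjea_aposteriori_estimate
    {X : Type*} [NormedAddCommGroup X] [NormedSpace ℝ X] [CompleteSpace X]
    (T : X → X) (k b : ℝ) (hk : 0 ≤ k) (hb0 : 0 ≤ b) (hb : b < 1 / 2)
    (hT : ∀ x y : X, ‖k • (x - y) + (T x - T y)‖ ≤
      b * (‖(k + 1) • (x - y) + (y - T y)‖ + ‖(k + 1) • (y - x) + (x - T x)‖))
    (p : X) (hp : T p = p) (hpu : ∀ q : X, T q = q → q = p)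
    (x₀ : X) (u : ℕ → X) (hu0 : u 0 = x₀)
    (hu : ∀ n, u (n + 1) = (1 - 1 / (k + 1)) • u n + (1 / (k + 1)) • T (u n)) :
    ∀ n : ℕ, 1 ≤ n →
      ‖u n - p‖ ≤ (b / (1 - b)) / (1 - b / (1 - b)) * ‖u n - u (n - 1)‖ := by
  intro n hn
  obtain ⟨m, rfl⟩ := Nat.exists_eq_add_of_le' hn
  rw [Nat.add_sub_cancel]
  have hk1 : 0 < k + 1 := by linarith
  have hTu : T (u m) = (k + 1) • u (m + 1) - k • u m := by
    rw [hu m, smul_add, smul_smul, smul_smul, mul_one_div_cancel hk1.ne',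
      show (k + 1) * (1 - 1 / (k + 1)) = k by field_simp; ring]
    module
  have h := hT (u m) p
  rw [hTu, hp,
    show k • (u m - p) + ((k + 1) • u (m + 1) - k • u m - p)
      = (k + 1) • (u (m + 1) - p) by module,
    show (k + 1) • (u m - p) + (p - p) = (k + 1) • (u m - p) by module,
    show (k + 1) • (p - u m) + (u m - ((k + 1) • u (m + 1) - k • u m))
      = (k + 1) • (p - u (m + 1)) by module,
    norm_smul, norm_smul, norm_smul, Real.norm_of_nonneg hk1.le, norm_sub_rev p,
    ← mul_add, mul_left_comm] at h
  have hcontr := le_of_mul_le_mul_left h hk1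
  have htri := norm_sub_le_norm_sub_add_norm_sub (u m) (u (m + 1)) p
  rw [norm_sub_rev (u m) (u (m + 1))] at htri
  have h1b : 1 - b ≠ 0 := by linarith
  have h2b : 0 < 1 - 2 * b := by linarith
  have hδ : b / (1 - b) / (1 - b / (1 - b)) = b / (1 - 2 * b) := by
    rw [one_sub_div h1b, div_div_div_cancel_right₀ h1b]
    ring
  rw [hδ, div_mul_eq_mul_div, le_div_iff₀ h2b]
  nlinarith [mul_le_mul_of_nonneg_left htri hb0]
end

section
/- Let (X, ‖·‖) be a Banach space and let T : X → X be a (k,h)-enriched Chatterjea type mapping with k ∈ [0,∞) and h ∈ [0,1). Then T has a unique fixed point p ∈ X, and setting λ = 1/(k+1) ∈ (0,1], for every x₀ ∈ X the Krasnoselskij iteration defined by x_{n+1} = (1−λ)x_n + λ T x_n converges to p. -/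
open Filter Topology

section ChatterjeaType

variable {α : Type*} [MetricSpace α] {S : α → α} {h : ℝ}

/-- Orbits of a map satisfying a Chatterjea type condition are bounded. -/
theorem dist_orbit_le_of_chatterjeaType (hh0 : 0 ≤ h) (hh : h < 1)
    (hS : ∀ x y, dist (S x) (S y) ≤ h * max (dist x (S y)) (dist y (S x)))
    {u : ℕ → α} (hu : ∀ n, u (n + 1) = S (u n)) (i j : ℕ) :
    dist (u i) (u j) ≤ dist (u 0) (u 1) / (1 - h) := by
  have step (i j : ℕ) : dist (u (i + 1)) (u (j + 1)) ≤
      h * max (dist (u i) (u (j + 1))) (dist (u j) (u (i + 1))) := by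
    simpa only [hu] using hS (u i) (u j)
  obtain ⟨⟨a, b⟩, hab, hmax⟩ := Finset.exists_max_image
    (Finset.range (i + j + 1) ×ˢ Finset.range (i + j + 1)) (fun p => dist (u p.1) (u p.2))
    ⟨(0, 0), by simp⟩
  simp only [Finset.mem_product, Finset.mem_range, Prod.forall] at hab hmax
  obtain ⟨ha, hb⟩ := hab
  have contract (m n : ℕ) (hm : m + 1 < i + j + 1) (hn : n + 1 < i + j + 1) :
      dist (u (m + 1)) (u (n + 1)) ≤ h * dist (u a) (u b) :=
    (step m n).trans <| mul_le_mul_of_nonneg_left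
      (max_le (hmax _ _ ⟨by omega, hn⟩) (hmax _ _ ⟨by omega, hm⟩)) hh0
  have head (n : ℕ) (hn : n + 1 < i + j + 1) :
      dist (u 0) (u (n + 1)) ≤ dist (u 0) (u 1) + h * dist (u a) (u b) :=
    (dist_triangle _ (u 1) _).trans (by gcongr; exact contract 0 n (by omega) hn)
  have hD : dist (u a) (u b) ≤ dist (u 0) (u 1) + h * dist (u a) (u b) := by
    rcases a with _ | a <;> rcases b with _ | b
    · simp
    · exact head b hb
    · rw [dist_comm (u (a + 1)) (u 0)] at head ⊢
      exact head a ha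
    · exact (contract a b ha hb).trans (le_add_of_nonneg_left dist_nonneg)
  rw [le_div_iff₀ (by linarith)]
  nlinarith [hmax i j ⟨by omega, by omega⟩]

/-- The distances within the tails of an orbit decay geometrically. -/
theorem dist_orbit_le_pow_of_chatterjeaType (hh0 : 0 ≤ h) (hh : h < 1)
    (hS : ∀ x y, dist (S x) (S y) ≤ h * max (dist x (S y)) (dist y (S x)))
    {u : ℕ → α} (hu : ∀ n, u (n + 1) = S (u n)) (n : ℕ) :
    ∀ i j, n ≤ i → n ≤ j → dist (u i) (u j) ≤ h ^ n * (dist (u 0) (u 1) / (1 - h)) := by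
  induction n with
  | zero =>
    intro i j _ _
    simpa using dist_orbit_le_of_chatterjeaType hh0 hh hS hu i j
  | succ n ih =>
    intro i j hi hj
    obtain ⟨i, rfl⟩ := Nat.exists_eq_add_of_le' (show 1 ≤ i by omega)
    obtain ⟨j, rfl⟩ := Nat.exists_eq_add_of_le' (show 1 ≤ j by omega)
    have hij := hS (u i) (u j)
    rw [← hu, ← hu] at hij
    rw [pow_succ', mul_assoc]
    exact hij.trans <| mul_le_mul_of_nonneg_left
      (max_le (ih _ _ (by omega) (by omega)) (ih _ _ (by omega) (by omega))) hh0

/-- In a complete space, every orbit of a map satisfying a Chatterjea type condition converges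
to a fixed point. -/
theorem exists_fixedPoint_tendsto_orbit_of_chatterjeaType [CompleteSpace α]
    (hh0 : 0 ≤ h) (hh : h < 1)
    (hS : ∀ x y, dist (S x) (S y) ≤ h * max (dist x (S y)) (dist y (S x)))
    {u : ℕ → α} (hu : ∀ n, u (n + 1) = S (u n)) :
    ∃ p, S p = p ∧ Tendsto u atTop (𝓝 p) := by
  have hcauchy : CauchySeq u := by
    refine cauchySeq_of_le_tendsto_0 (fun n => h ^ n * (dist (u 0) (u 1) / (1 - h)))
      (fun i j n hi hj => dist_orbit_le_pow_of_chatterjeaType hh0 hh hS hu n i j hi hj) ?_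
    simpa using (tendsto_pow_atTop_nhds_zero_of_lt_one hh0 hh).mul_const
      (dist (u 0) (u 1) / (1 - h))
  obtain ⟨p, hp⟩ := cauchySeq_tendsto_of_complete hcauchy
  refine ⟨p, ?_, hp⟩
  have hp' : Tendsto (fun n => u (n + 1)) atTop (𝓝 p) := (tendsto_add_atTop_iff_nat 1).2 hp
  have hle : dist p (S p) ≤ h * max (dist p (S p)) (dist p p) :=
    le_of_tendsto_of_tendsto' (hp'.dist tendsto_const_nhds)
      (((hp.dist tendsto_const_nhds).max (tendsto_const_nhds.dist hp')).const_mul h)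
      fun n => by simpa only [hu] using hS (u n) p
  rw [dist_self, max_eq_left dist_nonneg] at hle
  refine (dist_le_zero.1 ?_).symm
  nlinarith [dist_nonneg (x := p) (y := S p)]

/-- A map satisfying a Chatterjea type condition has at most one fixed point. -/
theorem fixedPoint_unique_of_chatterjeaType (hh : h < 1)
    (hS : ∀ x y, dist (S x) (S y) ≤ h * max (dist x (S y)) (dist y (S x)))
    {p q : α} (hp : S p = p) (hq : S q = q) : q = p := by
  have hle := hS q p
  rw [hp, hq, dist_comm p q, max_self] at hle
  refine dist_le_zero.1 ?_
  nlinarith [dist_nonneg (x := q) (y := p)]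

end ChatterjeaType

/-- **Theorem 3**: a `(k,h)`-enriched Chatterjea *type* mapping on a Banach space has a
unique fixed point `p`, and the Krasnoselskij iteration with `λ = 1/(k+1)` converges to `p`
from any starting point. -/
theorem enrichedChatterjeaType_fixedPoint_krasnoselskij
    {X : Type*} [NormedAddCommGroup X] [NormedSpace ℝ X] [CompleteSpace X]
    (T : X → X) (k h : ℝ) (hk : 0 ≤ k) (hh0 : 0 ≤ h) (hh : h < 1)
    (hT : ∀ x y : X, ‖k • (x - y) + (T x - T y)‖ ≤
      h * max ‖(k + 1) • (x - y) + (y - T y)‖ ‖(k + 1) • (y - x) + (x - T x)‖) :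
    ∃ p : X, T p = p ∧ (∀ q : X, T q = q → q = p) ∧
      ∀ (x₀ : X) (u : ℕ → X), u 0 = x₀ →
        (∀ n, u (n + 1) = (1 - 1 / (k + 1)) • u n + (1 / (k + 1)) • T (u n)) →
        Filter.Tendsto u Filter.atTop (nhds p) := by
  have hk1 : 0 < k + 1 := by linarith
  have hk1' : k + 1 ≠ 0 := hk1.ne'
  set S : X → X := fun x => (1 - 1 / (k + 1)) • x + (1 / (k + 1)) • T x with hSdef
  have hScale (x : X) : (k + 1) • S x = k • x + T x := by
    simp only [hSdef, smul_add, smul_smul]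
    rw [mul_one_div_cancel hk1', one_smul, mul_sub, mul_one_div_cancel hk1', mul_one,
      add_sub_cancel_right]
  have hdist (x y : X) : (k + 1) * dist x y = ‖(k + 1) • (x - y)‖ := by
    rw [norm_smul, Real.norm_of_nonneg hk1.le, dist_eq_norm]
  have hcross (x y : X) : (k + 1) • (x - S y) = (k + 1) • (x - y) + (y - T y) := by
    rw [smul_sub, hScale]
    module
  have hdiff (x y : X) : (k + 1) • (S x - S y) = k • (x - y) + (T x - T y) := by
    rw [smul_sub, hScale, hScale]
    module
  have hS (x y : X) : dist (S x) (S y) ≤ h * max (dist x (S y)) (dist y (S x)) := by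
    refine le_of_mul_le_mul_left ?_ hk1
    rw [mul_left_comm, mul_max_of_nonneg _ _ hk1.le, hdist (S x) (S y), hdist x (S y),
      hdist y (S x), hcross x y, hcross y x, hdiff]
    exact hT x y
  have hfix (x : X) : S x = x ↔ T x = x := by
    rw [← smul_right_inj hk1', hScale, add_smul, one_smul, add_right_inj]
  obtain ⟨p, hp, -⟩ := exists_fixedPoint_tendsto_orbit_of_chatterjeaType hh0 hh hS
    (u := fun n => S^[n] 0) fun n => Function.iterate_succ_apply' S n 0
  refine ⟨p, (hfix p).1 hp,
    fun q hq => fixedPoint_unique_of_chatterjeaType hh hS hp ((hfix q).2 hq), ?_⟩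
  intro x₀ u _ hu
  obtain ⟨q, hq, hlim⟩ := exists_fixedPoint_tendsto_orbit_of_chatterjeaType hh0 hh hS hu
  rwa [fixedPoint_unique_of_chatterjeaType hh hS hp hq] at hlim
end

section
/- Let (X,d) be a metric space and T : X → X a Kannan contraction with constant a ∈ [0,1/4), i.e., d(Tx,Ty) ≤ a(d(x,Tx) + d(y,Ty)) for all x, y ∈ X. Then T is a Chatterjea contraction with constant a/(1−2a) < 1/2, i.e., d(Tx,Ty) ≤ (a/(1−2a))·(d(x,Ty) + d(y,Tx)) for all x, y ∈ X. -/
/-- A Kannan contraction with constant `a < 1/4` is a Chatterjea contraction with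
constant `a/(1-2a) < 1/2`. -/
theorem kannanContraction_isChatterjea
    {X : Type*} [MetricSpace X] (T : X → X) (a : ℝ) (ha0 : 0 ≤ a) (ha : a < 1 / 4)
    (hT : ∀ x y : X, dist (T x) (T y) ≤ a * (dist x (T x) + dist y (T y))) :
    a / (1 - 2 * a) < 1 / 2 ∧
      ∀ x y : X, dist (T x) (T y) ≤ a / (1 - 2 * a) * (dist x (T y) + dist y (T x)) := by
  have hpos : 0 < 1 - 2 * a := by linarith
  refine ⟨by rw [div_lt_iff₀ hpos]; linarith, fun x y => ?_⟩
  have hx := dist_triangle_right x (T x) (T y)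
  have hy := dist_triangle y (T x) (T y)
  have hle : dist x (T x) + dist y (T y) ≤
      dist x (T y) + dist y (T x) + 2 * dist (T x) (T y) := by
    linarith
  rw [div_mul_eq_mul_div, le_div_iff₀ hpos]
  linarith [hT x y, mul_le_mul_of_nonneg_left hle ha0]
end

section
/- Let (X, ‖·‖) be a normed linear space, T : X → X a (k,b)-enriched Chatterjea mapping with k ∈ [0,∞) and b ∈ [0,1/2), and set λ = 1/(k+1). Then the averaged mapping T_λ, defined by T_λ x = (1−λ)x + λTx, is a Chatterjea contraction with constant b: ‖T_λ x − T_λ y‖ ≤ b(‖x − T_λ y‖ + ‖y − T_λ x‖) for all x, y ∈ X. -/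
/-- If `T` is a `(k,b)`-enriched Chatterjea mapping, then the averaged mapping
`T_λ x = (1-λ)x + λTx` with `λ = 1/(k+1)` is a Chatterjea contraction with constant `b`. -/
theorem averaged_of_enrichedChatterjea_isChatterjea
    {X : Type*} [NormedAddCommGroup X] [NormedSpace ℝ X]
    (T : X → X) (k b : ℝ) (hk : 0 ≤ k) (hb0 : 0 ≤ b) (hb : b < 1 / 2)
    (hT : ∀ x y : X, ‖k • (x - y) + (T x - T y)‖ ≤
      b * (‖(k + 1) • (x - y) + (y - T y)‖ + ‖(k + 1) • (y - x) + (x - T x)‖)) :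
    ∀ x y : X,
      ‖((1 - 1 / (k + 1)) • x + (1 / (k + 1)) • T x) -
          ((1 - 1 / (k + 1)) • y + (1 / (k + 1)) • T y)‖ ≤
        b * (‖x - ((1 - 1 / (k + 1)) • y + (1 / (k + 1)) • T y)‖ +
             ‖y - ((1 - 1 / (k + 1)) • x + (1 / (k + 1)) • T x)‖) := by
  intro x y
  have hpos : 0 < k + 1 := by linarith
  have hne : k + 1 ≠ 0 := hpos.ne'
  have norm_scale (v : X) : ‖(k + 1) • v‖ = (k + 1) * ‖v‖ := by
    rw [norm_smul, Real.norm_of_nonneg hpos.le]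
  have scale_sub (u v : X) :
      (k + 1) • (u - ((1 - 1 / (k + 1)) • v + (1 / (k + 1)) • T v)) =
        (k + 1) • (u - v) + (v - T v) := by
    match_scalars <;> field_simp <;> ring
  have scale_averaged_sub :
      (k + 1) • (((1 - 1 / (k + 1)) • x + (1 / (k + 1)) • T x) -
          ((1 - 1 / (k + 1)) • y + (1 / (k + 1)) • T y)) =
        k • (x - y) + (T x - T y) := by
    match_scalars <;> field_simp <;> ring
  have h := hT x y
  rw [← scale_averaged_sub, ← scale_sub x y, ← scale_sub y x,
    norm_scale, norm_scale, norm_scale, ← mul_add, mul_left_comm] at h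
  exact le_of_mul_le_mul_left h hpos
end

section
/- Let (X,d) be a metric space, T : X → X a Chatterjea contraction with constant b ∈ [0,1/2), δ = b/(1−b), and let (x_n) be the Picard iteration x_{n+1} = T x_n starting from any x₀ ∈ X. Then for all n ≥ 0 and m ≥ 1: d(x_{n+m}, x_n) ≤ δⁿ·((1 − δᵐ)/(1 − δ))·d(x₁, x₀); in particular (x_n) is a Cauchy sequence. -/
/-- A sequence whose consecutive distances shrink by the factor `r ≠ 1` satisfies the
geometric-sum bound on the distance between any two of its terms. -/
theorem dist_add_le_of_dist_succ_le_geometric {X : Type*} [PseudoMetricSpace X] {u : ℕ → X}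
    {r C : ℝ} (hr : r ≠ 1) (h : ∀ n, dist (u (n + 1)) (u n) ≤ r ^ n * C) (n m : ℕ) :
    dist (u (n + m)) (u n) ≤ r ^ n * ((1 - r ^ m) / (1 - r)) * C := by
  have hr' : 1 - r ≠ 0 := sub_ne_zero.mpr hr.symm
  induction m with
  | zero => simp
  | succ m ih =>
    calc dist (u (n + (m + 1))) (u n)
        ≤ dist (u (n + m + 1)) (u (n + m)) + dist (u (n + m)) (u n) := dist_triangle _ _ _
      _ ≤ r ^ (n + m) * C + r ^ n * ((1 - r ^ m) / (1 - r)) * C := add_le_add (h _) ih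
      _ = r ^ n * ((1 - r ^ (m + 1)) / (1 - r)) * C := by
        field_simp
        ring

/-- A Chatterjea contraction shrinks the distance between consecutive iterates by the factor
`b / (1 - b)`. -/
theorem dist_map_map_le_of_chatterjea {X : Type*} [PseudoMetricSpace X] {T : X → X} {b : ℝ}
    (hb0 : 0 ≤ b) (hb : b < 1)
    (hT : ∀ x y : X, dist (T x) (T y) ≤ b * (dist x (T y) + dist y (T x))) (x : X) :
    dist (T (T x)) (T x) ≤ b / (1 - b) * dist (T x) x := by
  have hlt : 0 < 1 - b := sub_pos.mpr hb
  have h₁ := hT (T x) x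
  have h₂ : dist x (T (T x)) ≤ dist (T x) x + dist (T (T x)) (T x) := by
    simpa only [dist_comm] using dist_triangle x (T x) (T (T x))
  rw [dist_self, zero_add] at h₁
  rw [div_mul_eq_mul_div, le_div_iff₀ hlt]
  linarith [mul_le_mul_of_nonneg_left h₂ hb0]

/-- For a Chatterjea contraction with `δ = b/(1-b)`, the Picard iterates satisfy
`d(xₙ₊ₘ, xₙ) ≤ δⁿ · (1-δᵐ)/(1-δ) · d(x₁, x₀)` for all `n ≥ 0`, `m ≥ 1`;
in particular the Picard iteration is a Cauchy sequence. -/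
theorem chatterjea_picard_cauchy
    {X : Type*} [MetricSpace X] (T : X → X) (b : ℝ) (hb0 : 0 ≤ b) (hb : b < 1 / 2)
    (hT : ∀ x y : X, dist (T x) (T y) ≤ b * (dist x (T y) + dist y (T x)))
    (x₀ : X) (u : ℕ → X) (hu0 : u 0 = x₀) (hu : ∀ n, u (n + 1) = T (u n)) :
    (∀ (n m : ℕ), 1 ≤ m →
      dist (u (n + m)) (u n) ≤
        (b / (1 - b)) ^ n * ((1 - (b / (1 - b)) ^ m) / (1 - b / (1 - b))) * dist (u 1) (u 0)) ∧
    CauchySeq u := by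
  have hlt : 0 < 1 - b := by linarith
  have hδ0 : 0 ≤ b / (1 - b) := div_nonneg hb0 hlt.le
  have hδ1 : b / (1 - b) < 1 := by
    rw [div_lt_one hlt]
    linarith
  have hstep : ∀ n, dist (u (n + 1)) (u n) ≤ (b / (1 - b)) ^ n * dist (u 1) (u 0) := by
    intro n
    induction n with
    | zero => simp
    | succ n ih =>
      calc dist (u (n + 1 + 1)) (u (n + 1))
          ≤ b / (1 - b) * dist (u (n + 1)) (u n) := by
            simpa only [hu] using dist_map_map_le_of_chatterjea hb0 (by linarith) hT (u n)
        _ ≤ b / (1 - b) * ((b / (1 - b)) ^ n * dist (u 1) (u 0)) :=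
            mul_le_mul_of_nonneg_left ih hδ0
        _ = (b / (1 - b)) ^ (n + 1) * dist (u 1) (u 0) := by ring
  refine ⟨fun n m _ => dist_add_le_of_dist_succ_le_geometric hδ1.ne hstep n m,
    cauchySeq_of_le_geometric (b / (1 - b)) (dist (u 1) (u 0)) hδ1 fun n => ?_⟩
  rw [dist_comm, mul_comm]
  exact hstep n
end

section
/- Let T : [0,1] → [0,1] be defined by Tx = 0 for x ∈ [0,1) and T(1) = 1/2. Then T satisfies the contraction condition |Tx − Ty| ≤ h·max{|x − Ty|, |y − Tx|} for all x, y ∈ [0,1] for every h with 1/2 ≤ h < 1, but T is not a Chatterjea contraction: there is no b ∈ [0,1/2) with |Tx − Ty| ≤ b(|x − Ty| + |y − Tx|) for all x, y ∈ [0,1]. -/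
/-- **Example 4**: the map `T` on `[0,1]` with `Tx = 0` for `x ∈ [0,1)` and `T1 = 1/2`
satisfies the Chatterjea-type condition `|Tx - Ty| ≤ h·max{|x - Ty|, |y - Tx|}` for every
`h ∈ [1/2, 1)`, but is not a Chatterjea contraction. -/
theorem chatterjeaType_not_chatterjea
    (T : ℝ → ℝ) (hT0 : ∀ x ∈ Set.Ico (0 : ℝ) 1, T x = 0) (hT1 : T 1 = 1 / 2) :
    (∀ h : ℝ, 1 / 2 ≤ h → h < 1 →
      ∀ x ∈ Set.Icc (0 : ℝ) 1, ∀ y ∈ Set.Icc (0 : ℝ) 1,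
        |T x - T y| ≤ h * max |x - T y| |y - T x|) ∧
    ¬ ∃ b : ℝ, 0 ≤ b ∧ b < 1 / 2 ∧
      ∀ x ∈ Set.Icc (0 : ℝ) 1, ∀ y ∈ Set.Icc (0 : ℝ) 1,
        |T x - T y| ≤ b * (|x - T y| + |y - T x|) := by
  constructor
  · intro h hh _ x hx y hy
    have hnonneg : 0 ≤ h * max |x - T y| |y - T x| :=
      mul_nonneg (by linarith) (le_max_of_le_left (abs_nonneg _))
    rcases hx.2.eq_or_lt with rfl | hx1 <;> rcases hy.2.eq_or_lt with rfl | hy1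
    · simpa using hnonneg
    · rw [hT0 y ⟨hy.1, hy1⟩, hT1]
      have hmax : (1 : ℝ) ≤ max |1 - 0| |y - 1 / 2| := le_max_of_le_left (by norm_num)
      calc |(1 / 2 : ℝ) - 0| = 1 / 2 * 1 := by norm_num
        _ ≤ _ := by gcongr
    · rw [hT0 x ⟨hx.1, hx1⟩, hT1]
      have hmax : (1 : ℝ) ≤ max |x - 1 / 2| |1 - 0| := le_max_of_le_right (by norm_num)
      calc |(0 : ℝ) - 1 / 2| = 1 / 2 * 1 := by norm_num
        _ ≤ _ := by gcongr
    · simpa [hT0 x ⟨hx.1, hx1⟩, hT0 y ⟨hy.1, hy1⟩] using hnonneg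
  · rintro ⟨b, _, hb, hT⟩
    have hhalf := hT 1 (by norm_num) (1 / 2) (by norm_num)
    rw [hT1, hT0 (1 / 2) (by norm_num)] at hhalf
    norm_num at hhalf
    linarith
end
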